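/- Assume A is free with exp(A) = (1, d_2,…,d_ℓ), d_2 ≤ … ≤ d_ℓ, and let H ∈ A. If A' := A \ {H} is locally free, then d := |A| − |A^H| equals d_i for some i, or d > d_ℓ. -/

import Mathlib

open MvPolynomial

noncomputable section

attribute [local instance] Classical.propDecidable

namespace ArrPOG

variable (K : Type) [Field K] (ℓ : ℕ)

/-- A polynomial vector field on `K^ℓ`: `θ = Σ θᵢ ∂/∂xᵢ`, identified with its
coefficient vector `(θ₁,…,θ_ℓ)` in `S = K[x₁,…,x_ℓ]`. -/
abbrev Deriv : Type := Fin ℓ → MvPolynomial (Fin ℓ) K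

variable {K ℓ}

/-- The linear polynomial `α_H ∈ S` associated to a linear form `φ ∈ V*`. -/
def linPoly (φ : Module.Dual K (Fin ℓ → K)) : MvPolynomial (Fin ℓ) K :=
  ∑ i, MvPolynomial.C (φ (Pi.single i 1)) * MvPolynomial.X i

/-- `θ(α)` for a derivation `θ` and the linear form `α` given by `φ ∈ V*`. -/
def applyLin (θ : Deriv K ℓ) (φ : Module.Dual K (Fin ℓ → K)) : MvPolynomial (Fin ℓ) K :=
  ∑ i, MvPolynomial.C (φ (Pi.single i 1)) * θ i

/-- An arrangement: a finite set of hyperplanes (kernels of nonzero linear forms). -/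
def IsArrangement (A : Finset (Submodule K (Fin ℓ → K))) : Prop :=
  ∀ H ∈ A, ∃ φ : Module.Dual K (Fin ℓ → K), φ ≠ 0 ∧ LinearMap.ker φ = H

/-- Essential: the common intersection of all members is `0`. -/
def Essential (A : Finset (Submodule K (Fin ℓ → K))) : Prop :=
  A.inf id = ⊥

/-- Membership in the logarithmic derivation module `D(A)`:
`θ(α_H) ∈ S·α_H` for every `H ∈ A`. -/
def InD (A : Finset (Submodule K (Fin ℓ → K))) (θ : Deriv K ℓ) : Prop :=
  ∀ H ∈ A, ∀ φ : Module.Dual K (Fin ℓ → K), LinearMap.ker φ = H → linPoly φ ∣ applyLin θ φ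

/-- A derivation is homogeneous of degree `n` if all its coefficients are. -/
def HomogDeriv (θ : Deriv K ℓ) (n : ℕ) : Prop := ∀ i, (θ i).IsHomogeneous n

/-- `θ₁,…,θₙ` generate `D(A)` as an `S`-module. -/
def GeneratesD {n : ℕ} (A : Finset (Submodule K (Fin ℓ → K))) (θ : Fin n → Deriv K ℓ) : Prop :=
  (∀ i, InD A (θ i)) ∧
    ∀ η, InD A η → ∃ c : Fin n → MvPolynomial (Fin ℓ) K, η = ∑ i, c i • θ i

/-- `S`-linear independence of a family of derivations. -/
def IndepD {n : ℕ} (θ : Fin n → Deriv K ℓ) : Prop :=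
  ∀ c : Fin n → MvPolynomial (Fin ℓ) K, (∑ i, c i • θ i) = 0 → ∀ i, c i = 0

/-- `A` is free with exponents `e`: `D(A)` has a homogeneous basis of degrees `e i`. -/
def IsFreeExp (A : Finset (Submodule K (Fin ℓ → K))) (e : Fin ℓ → ℕ) : Prop :=
  ∃ θ : Fin ℓ → Deriv K ℓ, (∀ i, HomogDeriv (θ i) (e i)) ∧ GeneratesD A θ ∧ IndepD θ

/-- `A` is free. -/
def IsFree (A : Finset (Submodule K (Fin ℓ → K))) : Prop := ∃ e, IsFreeExp A e

/-- `A` is plus-one generated with exponents `e`, level `lev`, realized by the minimal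
homogeneous generators `θ₁,…,θ_ℓ, φ` whose unique syzygy is `Σ fᵢ•θᵢ + α•φ = 0`:
this encodes the minimal free resolution
`0 → S[-lev-1] → S[-lev] ⊕ (⊕ S[-eᵢ]) → D(A) → 0`. -/
def IsPOGWith (A : Finset (Submodule K (Fin ℓ → K))) (e : Fin ℓ → ℕ) (lev : ℕ)
    (θ : Fin ℓ → Deriv K ℓ) (φ : Deriv K ℓ)
    (f : Fin ℓ → MvPolynomial (Fin ℓ) K) (α : MvPolynomial (Fin ℓ) K) : Prop :=
  (∀ i, InD A (θ i)) ∧ InD A φ ∧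
  (∀ i, HomogDeriv (θ i) (e i)) ∧ HomogDeriv φ lev ∧
  (∀ η, InD A η → ∃ (c : Fin ℓ → MvPolynomial (Fin ℓ) K) (g : MvPolynomial (Fin ℓ) K),
      η = (∑ i, c i • θ i) + g • φ) ∧
  α.IsHomogeneous 1 ∧
  (∀ i, (f i).IsHomogeneous (lev + 1 - e i)) ∧
  (∀ i, MvPolynomial.constantCoeff (f i) = 0) ∧
  ((∑ i, f i • θ i) + α • φ = 0) ∧
  (¬ (α = 0 ∧ ∀ i, f i = 0)) ∧
  (∀ (g : Fin ℓ → MvPolynomial (Fin ℓ) K) (h : MvPolynomial (Fin ℓ) K),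
      ((∑ i, g i • θ i) + h • φ = 0) →
      ∃ q : MvPolynomial (Fin ℓ) K, (∀ i, g i = q * f i) ∧ h = q * α)

/-- Plus-one generated with exponents `e` and level `lev`. -/
def IsPOG (A : Finset (Submodule K (Fin ℓ → K))) (e : Fin ℓ → ℕ) (lev : ℕ) : Prop :=
  ∃ θ φ f α, IsPOGWith A e lev θ φ f α

/-- Strictly plus-one generated: the level coefficient `α` is nonzero. -/
def IsSPOG (A : Finset (Submodule K (Fin ℓ → K))) (e : Fin ℓ → ℕ) (lev : ℕ) : Prop :=
  ∃ θ φ f α, IsPOGWith A e lev θ φ f α ∧ α ≠ 0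

/-- The restriction `A^H = {L ⊓ H | L ∈ A \ {H}}`. -/
def restrict (A : Finset (Submodule K (Fin ℓ → K))) (H : Submodule K (Fin ℓ → K)) :
    Finset (Submodule K (Fin ℓ → K)) :=
  (A.erase H).image (fun L => L ⊓ H)

/-- The localization `A_X = {L ∈ A | X ⊆ L}`. -/
def localize (A : Finset (Submodule K (Fin ℓ → K))) (X : Submodule K (Fin ℓ → K)) :
    Finset (Submodule K (Fin ℓ → K)) :=
  A.filter (fun L => X ≤ L)

/-- The intersection lattice of `A`, inside the ambient space `T`. -/
def latticeOf (T : Submodule K (Fin ℓ → K)) (A : Finset (Submodule K (Fin ℓ → K))) :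
    Finset (Submodule K (Fin ℓ → K)) :=
  A.powerset.image (fun B => T ⊓ B.inf id)

/-- The Möbius function of the poset `L` (intersection lattice with top `T`). -/
def mob (T : Submodule K (Fin ℓ → K)) (L : Finset (Submodule K (Fin ℓ → K)))
    (X : Submodule K (Fin ℓ → K)) : ℤ :=
  if X = T then 1
  else - ∑ Y ∈ (L.filter fun Z => X < Z).attach, mob T L Y.1
termination_by (L.filter fun Z => X < Z).card
decreasing_by
  obtain ⟨Y, hY⟩ := Y
  simp only [Finset.mem_filter] at hY
  apply Finset.card_lt_card
  rw [Finset.ssubset_def]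
  constructor
  · intro Z hZ
    simp only [Finset.mem_filter] at hZ ⊢
    exact ⟨hZ.1, lt_trans hY.2 hZ.2⟩
  · intro hsub
    have h2 := hsub (Finset.mem_filter.mpr ⟨hY.1, hY.2⟩)
    simp only [Finset.mem_filter] at h2
    exact lt_irrefl Y h2.2

/-- The characteristic polynomial `χ(A;t) = Σ_{X ∈ L(A)} μ(X) t^{dim X}`
of an arrangement inside the ambient space `T`. -/
def charPoly (T : Submodule K (Fin ℓ → K)) (A : Finset (Submodule K (Fin ℓ → K))) :
    Polynomial ℤ :=
  ∑ X ∈ latticeOf T A,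
    Polynomial.C (mob T (latticeOf T A) X) * Polynomial.X ^ (Module.finrank K X)

/-- The Betti number `b_i(A)`: `χ(A;t) = Σ (-1)^i b_i(A) t^{ℓ-i}`. -/
def bNum (A : Finset (Submodule K (Fin ℓ → K))) (i : ℕ) : ℤ :=
  (-1) ^ i * (charPoly (⊤ : Submodule K (Fin ℓ → K)) A).coeff (ℓ - i)

/-- Evaluation of the Poincaré polynomial `π(A;t) = Σ μ(X) (-t)^{codim X}` at `t : ℚ`. -/
def poincareEval (A : Finset (Submodule K (Fin ℓ → K))) (t : ℚ) : ℚ :=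
  ∑ X ∈ latticeOf ⊤ A,
    (mob (⊤ : Submodule K (Fin ℓ → K)) (latticeOf ⊤ A) X : ℚ) *
      (-t) ^ (ℓ - Module.finrank K X)

/-- The Euler derivation `θ_E = Σ xᵢ ∂/∂xᵢ`. -/
def eulerD : Deriv K ℓ := fun i => MvPolynomial.X i

/-- `A` is locally free: `A_X` is free for every `X ∈ L(A)` other than `∩_{H∈A} H`. -/
def LocallyFree (A : Finset (Submodule K (Fin ℓ → K))) : Prop :=
  ∀ X ∈ latticeOf ⊤ A, X ≠ A.inf id → IsFree (localize A X)

/-- Transport a finite set of subspaces contained in `T` to `K^m` along a linear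
isomorphism `T ≃ K^m`. -/
def transport {m : ℕ} (T : Submodule K (Fin ℓ → K)) (eqv : T ≃ₗ[K] (Fin m → K))
    (A : Finset (Submodule K (Fin ℓ → K))) : Finset (Submodule K (Fin m → K)) :=
  A.image fun L => (L.comap T.subtype).map eqv.toLinearMap

/-- An arrangement inside the subspace `T` is free with exponents `e`, i.e. it is free
after identifying `T` with a coordinate space. -/
def RestrFreeExp {m : ℕ} (T : Submodule K (Fin ℓ → K))
    (A : Finset (Submodule K (Fin ℓ → K))) (e : Fin m → ℕ) : Prop :=
  ∃ eqv : T ≃ₗ[K] (Fin m → K), IsFreeExp (transport T eqv A) e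

/-- The multiset of exponents. -/
def expMS {n : ℕ} (e : Fin n → ℕ) : Multiset ℕ := Finset.univ.val.map e

/-- `D(A)` has projective dimension at most 1: some finite generating set has a free
(possibly zero) syzygy module, i.e. there is a free resolution
`0 → S^m → S^n → D(A) → 0`. -/
def PdimLEOne (A : Finset (Submodule K (Fin ℓ → K))) : Prop :=
  ∃ (n m : ℕ) (θ : Fin n → Deriv K ℓ) (r : Fin m → Fin n → MvPolynomial (Fin ℓ) K),
    GeneratesD A θ ∧
    (∀ j, (∑ i, r j i • θ i) = 0) ∧
    (∀ c : Fin n → MvPolynomial (Fin ℓ) K, (∑ i, c i • θ i) = 0 →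
      ∃ q : Fin m → MvPolynomial (Fin ℓ) K, ∀ i, c i = ∑ j, q j * r j i) ∧
    (∀ q : Fin m → MvPolynomial (Fin ℓ) K, (∀ i, (∑ j, q j * r j i) = 0) → ∀ j, q j = 0)

/-- `A` has a free filtration `∅ = A₀ ⊂ A₁ ⊂ ⋯ ⊂ A_n = A`, `|A_i| = i`, each `A_i` free. -/
def HasFreeFiltration (A : Finset (Submodule K (Fin ℓ → K))) : Prop :=
  ∃ c : ℕ → Finset (Submodule K (Fin ℓ → K)),
    c A.card = A ∧ (∀ i ≤ A.card, (c i).card = i ∧ IsFree (c i)) ∧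
    ∀ i < A.card, c i ⊆ c (i + 1)

/-- The intersection lattices of `A` and `B` are isomorphic: there is a bijection of
hyperplanes preserving the rank of every subset (equivalently, a lattice isomorphism). -/
def LatticeEquiv (A B : Finset (Submodule K (Fin ℓ → K))) : Prop :=
  ∃ σ : Submodule K (Fin ℓ → K) → Submodule K (Fin ℓ → K),
    Set.BijOn σ ↑A ↑B ∧
    ∀ T ⊆ A, Module.finrank K ((T.inf id : Submodule K (Fin ℓ → K))) =
      Module.finrank K (((T.image σ).inf id : Submodule K (Fin ℓ → K)))



section Part1

lemma linPoly_add (φ ψ : Module.Dual K (Fin ℓ → K)) :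
    linPoly (φ + ψ) = linPoly φ + linPoly ψ := by
  simp [linPoly, add_mul, Finset.sum_add_distrib]

lemma linPoly_smul (c : K) (φ : Module.Dual K (Fin ℓ → K)) :
    linPoly (c • φ) = C c * linPoly φ := by
  simp [linPoly, Finset.mul_sum, mul_assoc]

lemma linPoly_sub (φ ψ : Module.Dual K (Fin ℓ → K)) :
    linPoly (φ - ψ) = linPoly φ - linPoly ψ := by
  simp [linPoly, sub_mul, Finset.sum_sub_distrib]

lemma linPoly_zero : linPoly (0 : Module.Dual K (Fin ℓ → K)) = 0 := by
  simp [linPoly]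

lemma applyLin_add (θ : Deriv K ℓ) (φ ψ : Module.Dual K (Fin ℓ → K)) :
    applyLin θ (φ + ψ) = applyLin θ φ + applyLin θ ψ := by
  simp [applyLin, add_mul, Finset.sum_add_distrib]

lemma applyLin_smul (θ : Deriv K ℓ) (c : K) (φ : Module.Dual K (Fin ℓ → K)) :
    applyLin θ (c • φ) = C c * applyLin θ φ := by
  simp [applyLin, Finset.mul_sum, mul_assoc]

lemma applyLin_sub_left (θ η : Deriv K ℓ) (φ : Module.Dual K (Fin ℓ → K)) :
    applyLin (θ - η) φ = applyLin θ φ - applyLin η φ := by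
  simp [applyLin, mul_sub, Finset.sum_sub_distrib]

lemma applyLin_smul_left (s : MvPolynomial (Fin ℓ) K) (θ : Deriv K ℓ)
    (φ : Module.Dual K (Fin ℓ → K)) :
    applyLin (s • θ) φ = s * applyLin θ φ := by
  simp only [applyLin, Finset.mul_sum, Pi.smul_apply, smul_eq_mul]
  exact Finset.sum_congr rfl fun i _ => by ring

lemma applyLin_sum_left {ι : Type*} (s : Finset ι) (θ : ι → Deriv K ℓ)
    (φ : Module.Dual K (Fin ℓ → K)) :
    applyLin (∑ i ∈ s, θ i) φ = ∑ i ∈ s, applyLin (θ i) φ := by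
  simp only [applyLin, Finset.sum_apply, Finset.mul_sum]
  exact Finset.sum_comm

lemma applyLin_euler (φ : Module.Dual K (Fin ℓ → K)) :
    applyLin (eulerD : Deriv K ℓ) φ = linPoly φ := rfl

lemma eval_linPoly (φ : Module.Dual K (Fin ℓ → K)) (v : Fin ℓ → K) :
    eval v (linPoly φ) = φ v := by
  rw [LinearMap.pi_apply_eq_sum_univ φ v]
  simp only [linPoly, map_sum, map_mul, eval_C, eval_X]
  refine Finset.sum_congr rfl fun i _ => ?_
  have : (Pi.single i 1 : Fin ℓ → K) = fun j => if i = j then 1 else 0 := by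
    ext j; simp [Pi.single_apply, eq_comm]
  simp [this, mul_comm]

lemma linPoly_eq_zero {φ : Module.Dual K (Fin ℓ → K)} (h : linPoly φ = 0) : φ = 0 := by
  ext1 i
  ext
  have := eval_linPoly φ (Pi.single i 1)
  rw [h] at this
  simpa using this.symm

lemma exists_coord {φ : Module.Dual K (Fin ℓ → K)} (h : φ ≠ 0) :
    ∃ j, φ (Pi.single j 1) ≠ 0 := by
  by_contra hc
  push Not at hc
  apply h
  ext i
  simpa using hc i

lemma linPoly_homog (φ : Module.Dual K (Fin ℓ → K)) : (linPoly φ).IsHomogeneous 1 := by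
  apply IsHomogeneous.sum
  intro i _
  exact isHomogeneous_C_mul_X _ _

/-- projection of dual along `φ`. -/
def tau (φ : Module.Dual K (Fin ℓ → K)) (j : Fin ℓ) (ψ : Module.Dual K (Fin ℓ → K)) :
    Module.Dual K (Fin ℓ → K) :=
  ψ - (ψ (Pi.single j 1) / φ (Pi.single j 1)) • φ

/-- The substitution eliminating `x_j` modulo `α`. -/
def sig (φ : Module.Dual K (Fin ℓ → K)) (j : Fin ℓ) :
    MvPolynomial (Fin ℓ) K →ₐ[K] MvPolynomial (Fin ℓ) K :=
  aeval (fun i => X i - (if i = j then C (φ (Pi.single j 1))⁻¹ * linPoly φ else 0))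

lemma sig_dvd (φ : Module.Dual K (Fin ℓ → K)) (j : Fin ℓ) (p : MvPolynomial (Fin ℓ) K) :
    linPoly φ ∣ p - sig φ j p := by
  rw [← Ideal.mem_span_singleton, ← Ideal.Quotient.eq]
  have : (Ideal.Quotient.mkₐ K (Ideal.span {linPoly φ})) =
      (Ideal.Quotient.mkₐ K (Ideal.span {linPoly φ})).comp (sig φ j) := by
    ext i
    simp only [AlgHom.comp_apply, sig, aeval_X, map_sub]
    split_ifs
    · have : (Ideal.Quotient.mkₐ K (Ideal.span {linPoly φ})) (linPoly φ) = 0 := by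
        simp only [Ideal.Quotient.mkₐ_eq_mk]
        rw [Ideal.Quotient.eq_zero_iff_mem]
        exact Ideal.mem_span_singleton_self _
      simp [this]
    · simp
  exact DFunLike.congr_fun this p

lemma sig_lin (φ : Module.Dual K (Fin ℓ → K)) (j : Fin ℓ) (ψ : Module.Dual K (Fin ℓ → K)) :
    sig φ j (linPoly ψ) = linPoly (tau φ j ψ) := by
  rw [tau, linPoly_sub, linPoly_smul]
  conv_lhs => rw [linPoly]
  simp only [sig, map_sum, map_mul, aeval_X, algHom_C, mul_sub, Finset.sum_sub_distrib]
  congr 1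
  simp [div_eq_mul_inv, mul_assoc]

lemma tau_self {φ : Module.Dual K (Fin ℓ → K)} {j : Fin ℓ} (h : φ (Pi.single j 1) ≠ 0) :
    tau φ j φ = 0 := by
  simp [tau, div_self h]

lemma sig_eq_zero_iff {φ : Module.Dual K (Fin ℓ → K)} {j : Fin ℓ} (h : φ (Pi.single j 1) ≠ 0)
    (p : MvPolynomial (Fin ℓ) K) : sig φ j p = 0 ↔ linPoly φ ∣ p := by
  constructor
  · intro hp
    have := sig_dvd φ j p
    rwa [hp, sub_zero] at this
  · rintro ⟨q, rfl⟩
    rw [map_mul, sig_lin, tau_self h, linPoly_zero, zero_mul]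

lemma sig_idem {φ : Module.Dual K (Fin ℓ → K)} {j : Fin ℓ} (h : φ (Pi.single j 1) ≠ 0)
    (p : MvPolynomial (Fin ℓ) K) : sig φ j (sig φ j p) = sig φ j p := by
  have := (sig_eq_zero_iff h _).2 (sig_dvd φ j p)
  rw [map_sub, sub_eq_zero] at this
  exact this.symm

lemma sig_homog (φ : Module.Dual K (Fin ℓ → K)) (j : Fin ℓ) {p : MvPolynomial (Fin ℓ) K} {n : ℕ}
    (hp : p.IsHomogeneous n) : (sig φ j p).IsHomogeneous n := by
  have := hp.aeval (fun i => X i - (if i = j then C (φ (Pi.single j 1))⁻¹ * linPoly φ else 0))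
    (n := 1) (by
      intro i
      refine (isHomogeneous_X _ _).sub ?_
      split_ifs
      · exact (linPoly_homog φ).C_mul _
      · exact isHomogeneous_zero _ _ _)
  rwa [one_mul] at this

lemma linPoly_prime {φ : Module.Dual K (Fin ℓ → K)} (h : φ ≠ 0) : Prime (linPoly φ) := by
  obtain ⟨j, hj⟩ := exists_coord h
  refine ⟨fun h0 => h (linPoly_eq_zero h0), ?_, ?_⟩
  · intro hu
    have := (sig_eq_zero_iff hj 1).2 hu.dvd
    simp at this
  · intro a b hab
    rw [← sig_eq_zero_iff hj] at hab ⊢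
    rw [← sig_eq_zero_iff hj]
    rw [map_mul] at hab
    exact mul_eq_zero.1 hab

lemma linPoly_dvd {φ ψ : Module.Dual K (Fin ℓ → K)} (h : φ ≠ 0) (hd : linPoly φ ∣ linPoly ψ) :
    ∃ c : K, ψ = c • φ := by
  obtain ⟨j, hj⟩ := exists_coord h
  rw [← sig_eq_zero_iff hj, sig_lin] at hd
  exact ⟨_, sub_eq_zero.1 (linPoly_eq_zero hd)⟩

lemma linPoly_dvd_ker {φ ψ : Module.Dual K (Fin ℓ → K)} (h : φ ≠ 0) (h' : ψ ≠ 0)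
    (hd : linPoly φ ∣ linPoly ψ) : LinearMap.ker φ = LinearMap.ker ψ := by
  obtain ⟨c, rfl⟩ := linPoly_dvd h hd
  have hc : c ≠ 0 := by rintro rfl; simp at h'
  rw [LinearMap.ker_smul _ _ hc]

lemma prod_pow_dvd {ι R : Type*} [CommRing R] [IsDomain R] (s : Finset ι) (β : ι → R) (k : ι → ℕ)
    (hp : ∀ i ∈ s, Prime (β i)) (hne : ∀ i ∈ s, ∀ j ∈ s, β i ∣ β j → i = j) (p : R)
    (hd : ∀ i ∈ s, β i ^ k i ∣ p) : ∏ i ∈ s, β i ^ k i ∣ p := by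
  induction s using Finset.induction_on with
  | empty => simp
  | insert a s ha ih =>
    obtain ⟨r, hr⟩ := ih (fun i hi => hp i (Finset.mem_insert_of_mem hi))
      (fun i hi j hj => hne i (Finset.mem_insert_of_mem hi) j (Finset.mem_insert_of_mem hj))
      (fun i hi => hd i (Finset.mem_insert_of_mem hi))
    have h1 := hd a (Finset.mem_insert_self _ _)
    have hpa := hp a (Finset.mem_insert_self _ _)
    rw [hr] at h1
    have h2 : ¬ β a ∣ ∏ i ∈ s, β i ^ k i := by
      rw [hpa.dvd_finsetProd_iff]
      rintro ⟨i, hi, hdi⟩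
      have := hne a (Finset.mem_insert_self _ _) i (Finset.mem_insert_of_mem hi)
        (hpa.dvd_of_dvd_pow hdi)
      exact ha (this ▸ hi)
    obtain ⟨t, ht⟩ := hpa.pow_dvd_of_dvd_mul_left _ h2 h1
    refine ⟨t, ?_⟩
    rw [Finset.prod_insert ha, hr, ht]; ring

lemma coeff_of_mul_homog {b f : MvPolynomial (Fin ℓ) K} {m n : ℕ} (hb : b.IsHomogeneous m)
    (hb0 : b ≠ 0) (hbf : (b * f).IsHomogeneous n) (dd : Fin ℓ →₀ ℕ) (hdd : coeff dd f ≠ 0) :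
    m + dd.degree = n := by
  by_contra hne
  have h1 : homogeneousComponent (m + dd.degree) (b * f) = b * homogeneousComponent dd.degree f := by
    letI : GradedAlgebra (homogeneousSubmodule (Fin ℓ) K) := gradedAlgebra
    have := DirectSum.coe_decompose_mul_add_of_left_mem
      (homogeneousSubmodule (Fin ℓ) K) (i := m) (j := dd.degree) (a := b) (b := f)
      ((mem_homogeneousSubmodule _ _).2 hb)
    rw [← decomposition.decompose'_apply, ← decomposition.decompose'_apply]
    exact this
  rw [homogeneousComponent_of_mem hbf, if_neg hne] at h1
  rcases mul_eq_zero.1 h1.symm with h | h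
  · exact hb0 h
  · apply hdd
    have := coeff_homogeneousComponent dd.degree f dd
    rw [h, if_pos rfl] at this
    simpa using this.symm

lemma cc_of_mul_homog {b f : MvPolynomial (Fin ℓ) K} {m n : ℕ} (hb : b.IsHomogeneous m)
    (hb0 : b ≠ 0) (hbf : (b * f).IsHomogeneous n) (hmn : m ≠ n) : constantCoeff f = 0 := by
  by_contra h
  have := coeff_of_mul_homog hb hb0 hbf 0 h
  simp at this
  exact hmn this

lemma homog_of_mul_homog {b f : MvPolynomial (Fin ℓ) K} {m n : ℕ} (hb : b.IsHomogeneous m)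
    (hb0 : b ≠ 0) (hbf : (b * f).IsHomogeneous (m + n)) : f.IsHomogeneous n := by
  intro dd hdd
  have := coeff_of_mul_homog hb hb0 hbf dd hdd
  have h2 : Finsupp.weight 1 dd = dd.degree :=
    (DFunLike.congr_fun (Finsupp.degree_eq_weight_one (R := ℕ) (σ := Fin ℓ)) dd).symm
  rw [h2]
  omega

lemma zero_of_mul_homog {b f : MvPolynomial (Fin ℓ) K} {m n : ℕ} (hb : b.IsHomogeneous m)
    (hb0 : b ≠ 0) (hbf : (b * f).IsHomogeneous n) (hmn : n < m) : f = 0 := by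
  ext dd
  by_contra h
  have := coeff_of_mul_homog hb hb0 hbf dd (by simpa using h)
  omega

end Part1

section Part2

lemma dual_span {φ ψ χ : Module.Dual K (Fin ℓ → K)}
    (h : LinearMap.ker φ ⊓ LinearMap.ker ψ ≤ LinearMap.ker χ) : ∃ x y : K, χ = x • φ + y • ψ := by
  have := mem_span_of_iInf_ker_le_ker (ι := Bool) (L := fun b => cond b φ ψ) (K := χ) (by
    rw [iInf_bool_eq]; exact h)
  have hr : Set.range (fun b => cond b φ ψ) = {φ, ψ} := by
    ext z; simp [eq_comm, or_comm]
  rw [hr, Submodule.mem_span_pair] at this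
  obtain ⟨x, y, hxy⟩ := this
  exact ⟨x, y, hxy.symm⟩

lemma dual_span_one {φ ψ : Module.Dual K (Fin ℓ → K)}
    (h : LinearMap.ker φ ≤ LinearMap.ker ψ) : ∃ x : K, ψ = x • φ := by
  obtain ⟨x, y, hxy⟩ := dual_span (φ := φ) (ψ := φ) (χ := ψ) (by simpa using h)
  exact ⟨x + y, by rw [hxy, add_smul]⟩

lemma inD_of (A : Finset (Submodule K (Fin ℓ → K)))
    (frm : Submodule K (Fin ℓ → K) → Module.Dual K (Fin ℓ → K))
    (hf : ∀ L ∈ A, frm L ≠ 0 ∧ LinearMap.ker (frm L) = L) (θ : Deriv K ℓ)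
    (h : ∀ L ∈ A, linPoly (frm L) ∣ applyLin θ (frm L)) : InD A θ := by
  intro L hL φ hφ
  have h1 := (hf L hL).2
  obtain ⟨c, hc⟩ := dual_span_one (φ := frm L) (ψ := φ) (by rw [h1, hφ])
  have hφ0 : φ ≠ 0 := by
    rintro rfl
    rw [LinearMap.ker_zero, ← h1, eq_comm, LinearMap.ker_eq_top] at hφ
    exact (hf L hL).1 hφ
  have hc0 : c ≠ 0 := by rintro rfl; simp at hc; exact hφ0 hc
  rw [hc, linPoly_smul, applyLin_smul]
  exact mul_dvd_mul_left _ (h L hL)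

lemma det_homog (M : Matrix (Fin ℓ) (Fin ℓ) (MvPolynomial (Fin ℓ) K)) (e : Fin ℓ → ℕ)
    (h : ∀ i k, (M i k).IsHomogeneous (e i)) : M.det.IsHomogeneous (∑ i, e i) := by
  rw [Matrix.det_apply]
  refine IsHomogeneous.sum _ _ _ fun s _ => ?_
  have h1 : (∏ i, M (s i) i).IsHomogeneous (∑ i, e i) := by
    rw [← Equiv.sum_comp s e]
    exact IsHomogeneous.prod _ _ _ fun i _ => h _ _
  rcases Int.units_eq_one_or (Equiv.Perm.sign s) with hs | hs
  · rw [hs, one_smul]; exact h1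
  · rw [hs, Units.neg_smul, one_smul]; exact h1.neg

lemma adj_homog (M : Matrix (Fin ℓ) (Fin ℓ) (MvPolynomial (Fin ℓ) K)) (e : Fin ℓ → ℕ)
    (h : ∀ i k, (M i k).IsHomogeneous (e i)) (j i : Fin ℓ) :
    (M.adjugate j i).IsHomogeneous ((∑ k, e k) - e i) := by
  rw [Matrix.adjugate_apply]
  have := det_homog (M.updateRow i (Pi.single j 1)) (Function.update e i 0) (by
    intro r k
    by_cases hr : r = i
    · subst hr
      rw [Matrix.updateRow_self, Function.update_self, Pi.single_apply]
      split_ifs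
      · exact isHomogeneous_one _ _
      · exact isHomogeneous_zero _ _ _
    · rw [Matrix.updateRow_ne hr, Function.update_of_ne hr]
      exact h r k)
  have h2 : ∑ k, Function.update e i 0 k = (∑ k, e k) - e i := by
    rw [Finset.sum_update_of_mem (Finset.mem_univ i), Finset.sdiff_singleton_eq_erase,
      ← Finset.add_sum_erase _ e (Finset.mem_univ i)]
    simp
  rwa [h2] at this

lemma mulVec_coord (θ : Fin ℓ → Deriv K ℓ) (φ : Module.Dual K (Fin ℓ → K)) (i : Fin ℓ) :
    Matrix.mulVec (Matrix.of θ) (fun k => C (φ (Pi.single k 1))) i = applyLin (θ i) φ := by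
  simp [Matrix.mulVec, dotProduct, applyLin, mul_comm]

lemma det_mul_coord (θ : Fin ℓ → Deriv K ℓ) (φ : Module.Dual K (Fin ℓ → K)) (j : Fin ℓ) :
    (Matrix.of θ).det * C (φ (Pi.single j 1)) =
      ∑ i, (Matrix.of θ).adjugate j i * applyLin (θ i) φ := by
  have h := Matrix.mulVec_mulVec (fun k => C (φ (Pi.single k 1)))
    (Matrix.of θ).adjugate (Matrix.of θ)
  rw [Matrix.adjugate_mul] at h
  have h2 := congrFun h j
  rw [Matrix.smul_mulVec, Matrix.one_mulVec] at h2
  simp only [Pi.smul_apply, smul_eq_mul] at h2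
  rw [← h2, Matrix.mulVec, dotProduct]
  exact Finset.sum_congr rfl fun i _ => by rw [mulVec_coord]

lemma det_ne_zero {θ : Fin ℓ → Deriv K ℓ} (h : IndepD θ) : (Matrix.of θ).det ≠ 0 := by
  intro h0
  obtain ⟨v, hv, hv0⟩ := Matrix.exists_vecMul_eq_zero_iff.2 h0
  apply hv
  funext i
  refine h v ?_ i
  rw [← hv0]
  funext k
  simp [Matrix.vecMul, dotProduct]

lemma C_isUnit {c : K} (hc : c ≠ 0) : IsUnit (C c : MvPolynomial (Fin ℓ) K) :=
  (isUnit_iff_ne_zero.2 hc).map C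

lemma det_dvd {A : Finset (Submodule K (Fin ℓ → K))}
    (frm : Submodule K (Fin ℓ → K) → Module.Dual K (Fin ℓ → K))
    (hf : ∀ L ∈ A, frm L ≠ 0 ∧ LinearMap.ker (frm L) = L) {θ : Fin ℓ → Deriv K ℓ}
    (hg : GeneratesD A θ) {L : Submodule K (Fin ℓ → K)} (hL : L ∈ A) :
    (Matrix.of θ).det ∣ linPoly (frm L) * (∏ L' ∈ A.erase L, linPoly (frm L')) ^ ℓ := by
  set R := ∏ L' ∈ A.erase L, linPoly (frm L') with hR
  obtain ⟨j, hj⟩ := exists_coord (hf L hL).1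
  set φ := frm L with hφ
  let v : Fin ℓ → MvPolynomial (Fin ℓ) K := fun i => if i = j then linPoly φ else
    - C (φ (Pi.single i 1) / φ (Pi.single j 1))
  let E : Matrix (Fin ℓ) (Fin ℓ) (MvPolynomial (Fin ℓ) K) :=
    (1 : Matrix (Fin ℓ) (Fin ℓ) (MvPolynomial (Fin ℓ) K)).updateCol j v
  have hE : E.det = linPoly φ := by
    have := Matrix.cramer_apply (1 : Matrix (Fin ℓ) (Fin ℓ) (MvPolynomial (Fin ℓ) K)) v j
    rw [Matrix.cramer_one] at this
    simp only [E]
    rw [← this]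
    simp [v]
  have hEa : ∀ i, linPoly φ ∣ applyLin (E i) φ := by
    intro i
    have hsplit : applyLin (E i) φ = C (φ (Pi.single j 1)) * v i +
        ∑ k ∈ Finset.univ.erase j, C (φ (Pi.single k 1)) *
          (1 : Matrix (Fin ℓ) (Fin ℓ) (MvPolynomial (Fin ℓ) K)) i k := by
      rw [applyLin, ← Finset.add_sum_erase _ _ (Finset.mem_univ j)]
      congr 1
      · simp [E]
      · refine Finset.sum_congr rfl fun k hk => ?_
        simp [E, Matrix.updateCol_ne (Finset.ne_of_mem_erase hk)]
    by_cases hij : i = j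
    · subst hij
      rw [hsplit, Finset.sum_eq_zero, add_zero]
      · simp [v]
      · intro k hk
        rw [Matrix.one_apply_ne (Finset.ne_of_mem_erase hk).symm, mul_zero]
    · rw [hsplit, Finset.sum_eq_single_of_mem i (by simp [hij])]
      · simp only [v, if_neg hij, Matrix.one_apply_eq, mul_one, mul_neg, ← C_mul]
        rw [mul_div_cancel₀ _ hj]
        simp
      · intro k _ hk
        rw [Matrix.one_apply_ne hk.symm, mul_zero]
  have hin : ∀ i, InD A (R • E i) := by
    intro i
    refine inD_of A frm hf _ fun L' hL' => ?_
    rw [applyLin_smul_left]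
    by_cases h : L' = L
    · subst h
      exact (hEa i).mul_left _
    · exact (Finset.dvd_prod_of_mem (fun L' => linPoly (frm L'))
        (Finset.mem_erase.2 ⟨h, hL'⟩)).mul_right _
  choose N hN using fun i => hg.2 _ (hin i)
  have hmat : R • E = Matrix.of N * Matrix.of θ := by
    ext1 i k
    have := congrFun (hN i) k
    simpa [Matrix.mul_apply] using this
  have hdet := congrArg Matrix.det hmat
  rw [Matrix.det_smul, Matrix.det_mul, hE, Fintype.card_fin] at hdet
  exact ⟨(Matrix.of N).det, by rw [mul_comm, hdet, mul_comm]⟩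

lemma not_dvd_prod {A : Finset (Submodule K (Fin ℓ → K))}
    (frm : Submodule K (Fin ℓ → K) → Module.Dual K (Fin ℓ → K))
    (hf : ∀ L ∈ A, frm L ≠ 0 ∧ LinearMap.ker (frm L) = L)
    {L : Submodule K (Fin ℓ → K)} (hL : L ∈ A) :
    ¬ linPoly (frm L) ∣ ∏ L' ∈ A.erase L, linPoly (frm L') := by
  rw [(linPoly_prime (hf L hL).1).dvd_finsetProd_iff]
  rintro ⟨L', hL', hd⟩
  have h' := Finset.mem_of_mem_erase hL'
  have := linPoly_dvd_ker (hf L hL).1 (hf L' h').1 hd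
  rw [(hf L hL).2, (hf L' h').2] at this
  exact (Finset.ne_of_mem_erase hL') this.symm

lemma sq_not_dvd_det {A : Finset (Submodule K (Fin ℓ → K))}
    (frm : Submodule K (Fin ℓ → K) → Module.Dual K (Fin ℓ → K))
    (hf : ∀ L ∈ A, frm L ≠ 0 ∧ LinearMap.ker (frm L) = L) {θ : Fin ℓ → Deriv K ℓ}
    (hg : GeneratesD A θ) {L : Submodule K (Fin ℓ → K)} (hL : L ∈ A) :
    ¬ linPoly (frm L) * linPoly (frm L) ∣ (Matrix.of θ).det := by
  intro h
  have h1 := h.trans (det_dvd frm hf hg hL)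
  have hp := linPoly_prime (hf L hL).1
  have h2 := (mul_dvd_mul_iff_left hp.ne_zero).1 h1
  exact not_dvd_prod frm hf hL (hp.dvd_of_dvd_pow h2)

lemma form_dvd_det {A : Finset (Submodule K (Fin ℓ → K))}
    (frm : Submodule K (Fin ℓ → K) → Module.Dual K (Fin ℓ → K))
    (hf : ∀ L ∈ A, frm L ≠ 0 ∧ LinearMap.ker (frm L) = L) {θ : Fin ℓ → Deriv K ℓ}
    (hg : GeneratesD A θ) {L : Submodule K (Fin ℓ → K)} (hL : L ∈ A) :
    linPoly (frm L) ∣ (Matrix.of θ).det := by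
  obtain ⟨j, hj⟩ := exists_coord (hf L hL).1
  rw [← (C_isUnit hj).dvd_mul_right, det_mul_coord]
  exact Finset.dvd_sum fun i _ => (hg.1 i L hL _ (hf L hL).2).mul_left _

lemma sum_exp {A : Finset (Submodule K (Fin ℓ → K))} (hne : A.Nonempty)
    (frm : Submodule K (Fin ℓ → K) → Module.Dual K (Fin ℓ → K))
    (hf : ∀ L ∈ A, frm L ≠ 0 ∧ LinearMap.ker (frm L) = L) {θ : Fin ℓ → Deriv K ℓ}
    (hg : GeneratesD A θ) (hi : IndepD θ) {e : Fin ℓ → ℕ} (he : ∀ i, HomogDeriv (θ i) (e i)) :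
    ∑ i, e i = A.card := by
  have hd0 := det_ne_zero hi
  have hQ : ∏ L ∈ A, linPoly (frm L) ∣ (Matrix.of θ).det := by
    have := prod_pow_dvd A (fun L => linPoly (frm L)) (fun _ => 1)
      (fun L hL => linPoly_prime (hf L hL).1)
      (fun L hL L' hL' hd => by
        have := linPoly_dvd_ker (hf L hL).1 (hf L' hL').1 hd
        rwa [(hf L hL).2, (hf L' hL').2] at this)
      (Matrix.of θ).det (fun L hL => by rw [pow_one]; exact form_dvd_det frm hf hg hL)
    simpa using this
  obtain ⟨r, hr⟩ := hQ
  have hr0 : r ≠ 0 := by rintro rfl; exact hd0 (by rw [hr, mul_zero])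
  have hru : IsUnit r := by
    by_contra hu
    obtain ⟨p, hp, hpr⟩ := WfDvdMonoid.exists_irreducible_factor hu hr0
    have hpp := hp.prime
    obtain ⟨L₀, hL₀⟩ := hne
    have h1 : p ∣ linPoly (frm L₀) * (∏ L' ∈ A.erase L₀, linPoly (frm L')) ^ ℓ :=
      (hpr.trans ⟨_, by rw [hr, mul_comm]⟩).trans (det_dvd frm hf hg hL₀)
    have h2 : ∃ L ∈ A, p ∣ linPoly (frm L) := by
      rcases hpp.dvd_or_dvd h1 with h | h
      · exact ⟨L₀, hL₀, h⟩
      · obtain ⟨L, hL, h⟩ := (hpp.dvd_finsetProd_iff _).1 (hpp.dvd_of_dvd_pow h)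
        exact ⟨L, Finset.mem_of_mem_erase hL, h⟩
    obtain ⟨L, hL, h⟩ := h2
    have h3 : linPoly (frm L) ∣ r :=
      (hp.associated_of_dvd (linPoly_prime (hf L hL).1).irreducible h).symm.dvd.trans hpr
    apply sq_not_dvd_det frm hf hg hL
    rw [hr]
    exact mul_dvd_mul (Finset.dvd_prod_of_mem (fun L => linPoly (frm L)) hL) h3
  have h1 : (Matrix.of θ).det.IsHomogeneous (∑ i, e i) := det_homog _ _ fun i k => he i k
  have h2 : (∏ L ∈ A, linPoly (frm L)).IsHomogeneous A.card := by
    have := IsHomogeneous.prod A (fun L => linPoly (frm L)) (fun _ => 1)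
      fun L _ => linPoly_homog _
    simpa using this
  have hQ0 : ∏ L ∈ A, linPoly (frm L) ≠ 0 := by
    intro h; rw [h, zero_mul] at hr; exact hd0 hr
  rw [hr] at h1
  by_contra hne
  have := cc_of_mul_homog h2 hQ0 h1 (fun h => hne h.symm)
  have hu := hru.map (constantCoeff (R := K) (σ := Fin ℓ))
  rw [this] at hu
  exact not_isUnit_zero hu

end Part2

section Part3

/-- set the first `k` variables to zero -/
def kill (K : Type) [Field K] (ℓ k : ℕ) : MvPolynomial (Fin ℓ) K →ₐ[K] MvPolynomial (Fin ℓ) K :=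
  aeval (fun i => if i.1 < k then 0 else X i)

lemma kill_X (k : ℕ) (i : Fin ℓ) : kill K ℓ k (X i) = if i.1 < k then 0 else X i := by
  simp [kill]

lemma height_kill (k : ℕ) (hk : k ≤ ℓ) : (k : ℕ∞) ≤ (RingHom.ker (kill K ℓ k)).height := by
  induction k with
  | zero => simp
  | succ k ih =>
    have hp : (RingHom.ker (kill K ℓ k)).IsPrime := RingHom.ker_isPrime _
    have hp' : (RingHom.ker (kill K ℓ (k + 1))).IsPrime := RingHom.ker_isPrime _
    have hc : (kill K ℓ (k + 1)).comp (kill K ℓ k) = kill K ℓ (k + 1) := by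
      ext1 i
      rw [AlgHom.comp_apply, kill_X]
      split_ifs with h
      · rw [map_zero, kill_X, if_pos (by omega)]
      · rfl
    have hlt : RingHom.ker (kill K ℓ k) < RingHom.ker (kill K ℓ (k + 1)) := by
      refine lt_of_le_of_ne ?_ ?_
      · intro p hp
        rw [RingHom.mem_ker] at hp ⊢
        rw [← hc, AlgHom.comp_apply, hp, map_zero]
      · intro heq
        have h1 : (X ⟨k, by omega⟩ : MvPolynomial (Fin ℓ) K) ∈ RingHom.ker (kill K ℓ (k + 1)) := by
          rw [RingHom.mem_ker, kill_X, if_pos (by simp)]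
        rw [← heq, RingHom.mem_ker, kill_X, if_neg (by simp)] at h1
        exact X_ne_zero _ h1
    have h2 := Ideal.height_add_one_le_of_lt_of_isPrime hlt
    push_cast
    exact (add_le_add_left (ih (by omega)) 1).trans h2

lemma exists_prime (s : Finset (MvPolynomial (Fin ℓ) K)) (hs : s.card < ℓ)
    (hc : ∀ f ∈ s, constantCoeff f = 0) :
    ∃ P : Ideal (MvPolynomial (Fin ℓ) K), P.IsPrime ∧ (∀ f ∈ s, f ∈ P) ∧
      (∀ p ∈ P, constantCoeff p = 0) ∧ ∃ i, X i ∉ P := by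
  have hm : (RingHom.ker (constantCoeff (R := K) (σ := Fin ℓ))).IsPrime := RingHom.ker_isPrime _
  have hle : Ideal.span (s : Set (MvPolynomial (Fin ℓ) K)) ≤
      RingHom.ker (constantCoeff (R := K) (σ := Fin ℓ)) := by
    rw [Ideal.span_le]
    intro f hf
    exact hc f hf
  obtain ⟨P, hP, hPm⟩ := Ideal.exists_minimalPrimes_le hle
  refine ⟨P, hP.1.1, fun f hf => hP.1.2 (Ideal.subset_span hf), fun p hp => hPm hp, ?_⟩
  by_contra hX
  push Not at hX
  have h1 := Ideal.height_le_card_of_mem_minimalPrimes_span_finset hP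
  have h2 : RingHom.ker (kill K ℓ ℓ) ≤ P := by
    intro p hp
    rw [RingHom.mem_ker] at hp
    have hq : (Ideal.Quotient.mkₐ K P).comp (kill K ℓ ℓ) = Ideal.Quotient.mkₐ K P := by
      ext1 i
      rw [AlgHom.comp_apply, kill_X, if_pos i.2, map_zero, eq_comm]
      exact Ideal.Quotient.eq_zero_iff_mem.2 (hX i)
    have := DFunLike.congr_fun hq p
    rw [AlgHom.comp_apply, hp, map_zero] at this
    exact Ideal.Quotient.eq_zero_iff_mem.1 this.symm
  have h3 := (height_kill (K := K) (ℓ := ℓ) ℓ le_rfl).trans ((Ideal.height_mono h2).trans h1)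
  exact absurd (by exact_mod_cast h3) (not_le.2 hs)

/-- adjugate vanishes if there are two independent kernel vectors -/
lemma adj_eq_zero {R : Type*} [CommRing R] [IsDomain R] (M : Matrix (Fin ℓ) (Fin ℓ) R)
    (a b : Fin ℓ → R) (ha : M.mulVec a = 0) (hb : M.mulVec b = 0)
    (hab : ∀ s t : R, s • a + t • b = 0 → s = 0 ∧ t = 0) : M.adjugate = 0 := by
  ext i j
  rw [Matrix.adjugate_apply, Matrix.zero_apply, ← Matrix.exists_mulVec_eq_zero_iff]
  have key : ∀ c : Fin ℓ → R, c i = 0 → M.mulVec c = 0 →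
      (M.updateRow j (Pi.single i 1)).mulVec c = 0 := by
    intro c hc hMc
    funext r
    by_cases hr : r = j
    · subst hr
      simp [Matrix.mulVec, hc]
    · have := congrFun hMc r
      simpa [Matrix.mulVec, Matrix.updateRow_ne hr] using this
  by_cases hai : a i = 0
  · refine ⟨a, ?_, key a hai ha⟩
    rintro rfl
    have := (hab 1 0 (by simp)).1
    exact one_ne_zero this
  · refine ⟨b i • a + (- a i) • b, ?_, key _ ?_ ?_⟩
    · intro h
      exact hai (neg_eq_zero.1 (hab _ _ h).2)
    · simp; ring
    · rw [Matrix.mulVec_add, Matrix.mulVec_smul, Matrix.mulVec_smul, ha, hb]; simp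

lemma det_mul_rect {R : Type*} [CommRing R] [IsDomain R] {n : ℕ}
    (T : Matrix (Option (Fin n)) (Fin n) R) (U : Matrix (Fin n) (Option (Fin n)) R) :
    (T * U).det = 0 := by
  by_contra h
  have h1 := Matrix.rank_of_det_ne_zero h
  have h2 := (Matrix.rank_mul_le_left T U).trans (Matrix.rank_le_card_width T)
  rw [h1] at h2
  simp at h2

lemma local_contra (w : Option (Fin ℓ) → Deriv K ℓ) (ψ : Fin ℓ → Deriv K ℓ)
    (P : Ideal (MvPolynomial (Fin ℓ) K)) (hP : P.IsPrime) (q : MvPolynomial (Fin ℓ) K) (hq : q ∉ P)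
    (hrel : ∀ g : Option (Fin ℓ) → MvPolynomial (Fin ℓ) K, ∑ i, g i • w i = 0 → ∀ i, g i ∈ P)
    (hT : ∀ i, ∃ c : Fin ℓ → MvPolynomial (Fin ℓ) K, w i = ∑ k, c k • ψ k)
    (hU : ∀ k, ∃ c : Option (Fin ℓ) → MvPolynomial (Fin ℓ) K, q • ψ k = ∑ i, c i • w i) :
    False := by
  choose T hT using hT
  choose U hU using hU
  have h1 : ∀ i k, (Matrix.of T * Matrix.of U - q • (1 : Matrix (Option (Fin ℓ)) (Option (Fin ℓ)) (MvPolynomial (Fin ℓ) K))) i k ∈ P := by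
    intro i
    apply hrel
    simp only [Matrix.sub_apply, Matrix.mul_apply, Matrix.smul_apply, Matrix.of_apply, sub_smul,
      Finset.sum_sub_distrib, Finset.sum_smul]
    rw [Finset.sum_comm, sub_eq_zero]
    have e1 : ∀ y, ∑ x, (T i y * U y x) • w x = q • T i y • ψ y := by
      intro y
      rw [smul_comm, hU, Finset.smul_sum]
      exact Finset.sum_congr rfl fun x _ => by rw [mul_smul]
    rw [Finset.sum_congr rfl fun y _ => e1 y, ← Finset.smul_sum, ← hT,
      Finset.sum_eq_single_of_mem i (Finset.mem_univ i)]
    · simp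
    · intro b _ hb
      simp [Matrix.one_apply_ne hb.symm]
  let π := Ideal.Quotient.mk P
  have h2 : (Matrix.of T).map π * (Matrix.of U).map π =
      (π q) • (1 : Matrix (Option (Fin ℓ)) (Option (Fin ℓ)) (MvPolynomial (Fin ℓ) K ⧸ P)) := by
    ext1 i k
    have := Ideal.Quotient.eq_zero_iff_mem.2 (h1 i k)
    rw [Matrix.sub_apply, map_sub, sub_eq_zero] at this
    rw [← Matrix.map_mul, Matrix.map_apply]
    refine this.trans ?_
    by_cases hik : i = k
    · subst hik; simp [π]
    · simp [Matrix.one_apply_ne hik]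
  have h3 := det_mul_rect ((Matrix.of T).map π) ((Matrix.of U).map π)
  rw [h2, Matrix.det_smul, Matrix.det_one, mul_one] at h3
  exact hq (Ideal.Quotient.eq_zero_iff_mem.1 (pow_eq_zero_iff (by simp) |>.1 h3))

end Part3

section Part4

variable {A : Finset (Submodule K (Fin ℓ → K))}
    {frm : Submodule K (Fin ℓ → K) → Module.Dual K (Fin ℓ → K)}
    {H : Submodule K (Fin ℓ → K)} {j : Fin ℓ}

lemma tau_ne_zero (hf : ∀ L ∈ A, frm L ≠ 0 ∧ LinearMap.ker (frm L) = L) (hH : H ∈ A)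
    {L : Submodule K (Fin ℓ → K)} (hL : L ∈ A.erase H) : tau (frm H) j (frm L) ≠ 0 := by
  intro h
  have hL' := Finset.mem_of_mem_erase hL
  have := sub_eq_zero.1 h
  have h2 := linPoly_dvd_ker (hf H hH).1 (hf L hL').1
    (by rw [this, linPoly_smul]; exact dvd_mul_left _ _)
  rw [(hf H hH).2, (hf L hL').2] at h2
  exact Finset.ne_of_mem_erase hL h2.symm

lemma tau_comb {φ : Module.Dual K (Fin ℓ → K)} (hj : φ (Pi.single j 1) ≠ 0)
    (ψ : Module.Dual K (Fin ℓ → K)) (x y : K) :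
    tau φ j (x • φ + y • ψ) = y • tau φ j ψ := by
  ext i
  simp [tau]
  field_simp
  ring

lemma same_trace (hf : ∀ L ∈ A, frm L ≠ 0 ∧ LinearMap.ker (frm L) = L) (hH : H ∈ A)
    {L L' : Submodule K (Fin ℓ → K)} (hL : L ∈ A.erase H) (hL' : L' ∈ A.erase H)
    (h : L ⊓ H = L' ⊓ H) : ∃ x y : K, y ≠ 0 ∧ frm L' = x • frm H + y • frm L := by
  have h1 := Finset.mem_of_mem_erase hL
  have h2 := Finset.mem_of_mem_erase hL'
  obtain ⟨x, y, hxy⟩ := dual_span (φ := frm H) (ψ := frm L) (χ := frm L') (by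
    rw [(hf H hH).2, (hf L h1).2, (hf L' h2).2, inf_comm, h]; exact inf_le_left)
  refine ⟨x, y, ?_, hxy⟩
  rintro rfl
  rw [zero_smul, add_zero] at hxy
  have h3 := linPoly_dvd_ker (hf H hH).1 (hf L' h2).1
    (by rw [hxy, linPoly_smul]; exact dvd_mul_left _ _)
  rw [(hf H hH).2, (hf L' h2).2] at h3
  exact Finset.ne_of_mem_erase hL' h3.symm

lemma trace_of_tau_dvd (hf : ∀ L ∈ A, frm L ≠ 0 ∧ LinearMap.ker (frm L) = L) (hH : H ∈ A)
    {L L' : Submodule K (Fin ℓ → K)} (hL : L ∈ A.erase H) (hL' : L' ∈ A.erase H)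
    (h : linPoly (tau (frm H) j (frm L)) ∣ linPoly (tau (frm H) j (frm L'))) :
    L ⊓ H = L' ⊓ H := by
  have h1 := Finset.mem_of_mem_erase hL
  have h2 := Finset.mem_of_mem_erase hL'
  have hk := linPoly_dvd_ker (tau_ne_zero hf hH hL) (tau_ne_zero hf hH hL') h
  have key : ∀ ψ : Module.Dual K (Fin ℓ → K), LinearMap.ker ψ ⊓ LinearMap.ker (frm H) =
      LinearMap.ker (tau (frm H) j ψ) ⊓ LinearMap.ker (frm H) := by
    intro ψ
    ext v
    simp only [Submodule.mem_inf, LinearMap.mem_ker, tau, LinearMap.sub_apply,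
      LinearMap.smul_apply]
    constructor
    · rintro ⟨h1, h2⟩; simp [h1, h2]
    · rintro ⟨h1, h2⟩; rw [h2] at h1; simp at h1; exact ⟨h1, h2⟩
  have a1 := key (frm L)
  have a2 := key (frm L')
  rw [(hf L h1).2, (hf H hH).2] at a1
  rw [(hf L' h2).2, (hf H hH).2] at a2
  rw [a1, a2, hk]

lemma terao_one (hf : ∀ L ∈ A, frm L ≠ 0 ∧ LinearMap.ker (frm L) = L) (hH : H ∈ A)
    (hj : frm H (Pi.single j 1) ≠ 0)
    {η : Deriv K ℓ} (hη : InD (A.erase H) η) {L : Submodule K (Fin ℓ → K)} (hL : L ∈ A.erase H) :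
    linPoly (tau (frm H) j (frm L)) ^ (((A.erase H).filter (fun L' => L' ⊓ H = L ⊓ H)).card - 1) ∣
      sig (frm H) j (applyLin η (frm H)) := by
  set F := (A.erase H).filter (fun L' => L' ⊓ H = L ⊓ H) with hF
  have hLF : L ∈ F := by simp [hF]; simpa using hL
  have hmem : ∀ L' ∈ F.erase L, L' ≠ L ∧ L' ∈ A.erase H ∧ L' ⊓ H = L ⊓ H := by
    intro L' h
    rw [Finset.mem_erase, hF, Finset.mem_filter] at h
    exact ⟨h.1, h.2.1, h.2.2⟩
  obtain ⟨r, hr⟩ := hη L hL _ (hf L (Finset.mem_of_mem_erase hL)).2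
  have hd : ∀ L' ∈ F.erase L, linPoly (frm L') ^ 1 ∣ applyLin η (frm H) - linPoly (frm H) * r := by
    intro L' h
    obtain ⟨hne, hL', htr⟩ := hmem L' h
    obtain ⟨x, y, hy, hxy⟩ := same_trace hf hH hL hL' htr.symm
    have hx : x ≠ 0 := by
      rintro rfl
      rw [zero_smul, zero_add] at hxy
      have h3 := linPoly_dvd_ker (hf L (Finset.mem_of_mem_erase hL)).1
        (hf L' (Finset.mem_of_mem_erase hL')).1
        (by rw [hxy, linPoly_smul]; exact dvd_mul_left _ _)
      rw [(hf L (Finset.mem_of_mem_erase hL)).2, (hf L' (Finset.mem_of_mem_erase hL')).2] at h3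
      exact hne h3.symm
    rw [pow_one, ← (C_isUnit hx).dvd_mul_left]
    have h4 := hη L' hL' _ (hf L' (Finset.mem_of_mem_erase hL')).2
    have h5 : C x * (applyLin η (frm H) - linPoly (frm H) * r) =
        applyLin η (frm L') - linPoly (frm L') * r := by
      rw [hxy, applyLin_add, applyLin_smul, applyLin_smul, linPoly_add, linPoly_smul,
        linPoly_smul, hr]
      ring
    rw [h5]
    exact dvd_sub h4 (dvd_mul_right _ _)
  have hprod := prod_pow_dvd (F.erase L) (fun L => linPoly (frm L)) (fun _ => 1)
    (fun L' h => linPoly_prime (hf L' (Finset.mem_of_mem_erase (hmem L' h).2.1)).1)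
    (fun L₁ h₁ L₂ h₂ hdd => by
      have m1 := (Finset.mem_of_mem_erase (hmem L₁ h₁).2.1)
      have m2 := (Finset.mem_of_mem_erase (hmem L₂ h₂).2.1)
      have := linPoly_dvd_ker (hf L₁ m1).1 (hf L₂ m2).1 hdd
      rwa [(hf L₁ m1).2, (hf L₂ m2).2] at this) _ hd
  have h6 := map_dvd (sig (frm H) j) hprod
  rw [map_sub, map_mul, (sig_eq_zero_iff hj _).2 dvd_rfl, zero_mul, sub_zero, map_prod] at h6
  refine dvd_trans ?_ h6
  rw [← Finset.card_erase_of_mem hLF, ← Finset.prod_const]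
  refine Finset.prod_dvd_prod_of_dvd _ _ fun L' h => ?_
  obtain ⟨hne, hL', htr⟩ := hmem L' h
  obtain ⟨x, y, hy, hxy⟩ := same_trace hf hH hL hL' htr.symm
  rw [pow_one, sig_lin, hxy, tau_comb hj, linPoly_smul]
  exact dvd_mul_left _ _

lemma adj_one (hf : ∀ L ∈ A, frm L ≠ 0 ∧ LinearMap.ker (frm L) = L) (hH : H ∈ A)
    (hj : frm H (Pi.single j 1) ≠ 0) {θ : Fin ℓ → Deriv K ℓ} (hθ : ∀ i, InD A (θ i))
    {L : Submodule K (Fin ℓ → K)} (hL : L ∈ A.erase H) (i : Fin ℓ) :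
    linPoly (tau (frm H) j (frm L)) ∣ sig (frm H) j ((Matrix.of θ).adjugate j i) := by
  set τ := tau (frm H) j (frm L) with hτ
  have hτ0 : τ ≠ 0 := tau_ne_zero hf hH hL
  have hLA := Finset.mem_of_mem_erase hL
  have hpr := linPoly_prime hτ0
  have hP : (Ideal.span {linPoly τ}).IsPrime :=
    (Ideal.span_singleton_prime hpr.ne_zero).2 hpr
  let π : MvPolynomial (Fin ℓ) K →+* MvPolynomial (Fin ℓ) K ⧸ Ideal.span {linPoly τ} :=
    (Ideal.Quotient.mk (Ideal.span {linPoly τ})).comp (sig (frm H) j : _ →+* _)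
  have hπ0 : ∀ p, π p = 0 ↔ linPoly τ ∣ sig (frm H) j p := by
    intro p
    rw [← Ideal.mem_span_singleton, ← Ideal.Quotient.eq_zero_iff_mem]; rfl
  have hπC : ∀ c : K, π (C c) = 0 → c = 0 := by
    intro c h
    rw [hπ0, algHom_C] at h
    by_contra hc
    exact hpr.not_isUnit (isUnit_of_dvd_unit h (C_isUnit hc))
  rw [← hπ0]
  have h0 := adj_eq_zero ((Matrix.of θ).map π) (fun k => π (C (frm H (Pi.single k 1))))
    (fun k => π (C (frm L (Pi.single k 1)))) ?_ ?_ ?_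
  · have := congrFun (congrFun (RingHom.map_adjugate π (Matrix.of θ)) j) i
    rw [RingHom.mapMatrix_apply, RingHom.mapMatrix_apply, h0] at this
    exact this
  · funext r
    have h1 := mulVec_coord θ (frm H) r
    have h2 : π (applyLin (θ r) (frm H)) = 0 := by
      rw [hπ0, (sig_eq_zero_iff hj _).2 (hθ r H hH _ (hf H hH).2)]
      exact dvd_zero _
    rw [← h1, Matrix.mulVec, dotProduct, map_sum] at h2
    simpa [Matrix.mulVec, dotProduct] using h2
  · funext r
    have h1 := mulVec_coord θ (frm L) r
    have h2 : π (applyLin (θ r) (frm L)) = 0 := by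
      rw [hπ0]
      have := map_dvd (sig (frm H) j) (hθ r L hLA _ (hf L hLA).2)
      rwa [sig_lin] at this
    rw [← h1, Matrix.mulVec, dotProduct, map_sum] at h2
    simpa [Matrix.mulVec, dotProduct] using h2
  · intro s t hst
    obtain ⟨k, hk⟩ := exists_coord hτ0
    have e1 : ∀ r, s * π (C (frm H (Pi.single r 1))) + t * π (C (frm L (Pi.single r 1))) = 0 :=
      fun r => by simpa using congrFun hst r
    have ht : t = 0 := by
      have : t * π (C (τ (Pi.single k 1))) = 0 := by
        have e2 : C (τ (Pi.single k 1)) = C (frm L (Pi.single k 1)) -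
            C (frm L (Pi.single j 1) / frm H (Pi.single j 1)) *
              (C (frm H (Pi.single k 1)) : MvPolynomial (Fin ℓ) K) := by
          rw [← C_mul, ← C_sub]; simp [hτ, tau]
        have e3 : (C (frm L (Pi.single j 1)) : MvPolynomial (Fin ℓ) K) =
            C (frm L (Pi.single j 1) / frm H (Pi.single j 1)) *
              (C (frm H (Pi.single j 1)) : MvPolynomial (Fin ℓ) K) := by
          rw [← C_mul, div_mul_cancel₀ _ hj]
        have a1 := e1 k
        have a2 := e1 j
        rw [e3, map_mul] at a2
        have hu : π (C (frm H (Pi.single j 1))) ≠ 0 := fun h => hj (hπC _ h)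
        have a3 : s + t * π (C (frm L (Pi.single j 1) / frm H (Pi.single j 1))) = 0 := by
          apply mul_right_cancel₀ hu
          rw [zero_mul]; linear_combination a2
        rw [e2, map_sub, map_mul]
        linear_combination a1 - π (C (frm H (Pi.single k 1))) * a3
      rcases mul_eq_zero.1 this with h | h
      · exact h
      · exact absurd (hπC _ h) hk
    refine ⟨?_, ht⟩
    have a2 := e1 j
    rw [ht, zero_mul, add_zero] at a2
    rcases mul_eq_zero.1 a2 with h | h
    · exact h
    · exact absurd (hπC _ h) hj

end Part4

section Part5

variable {A : Finset (Submodule K (Fin ℓ → K))}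
    {frm : Submodule K (Fin ℓ → K) → Module.Dual K (Fin ℓ → K)}
    {H : Submodule K (Fin ℓ → K)} {j : Fin ℓ}

lemma inD_of_erase (hf : ∀ L ∈ A, frm L ≠ 0 ∧ LinearMap.ker (frm L) = L) {η : Deriv K ℓ}
    (h : InD (A.erase H) η) (h' : linPoly (frm H) ∣ applyLin η (frm H)) : InD A η := by
  refine inD_of A frm hf η fun L hL => ?_
  by_cases hLH : L = H
  · subst hLH; exact h'
  · exact h L (Finset.mem_erase.2 ⟨hLH, hL⟩) _ (hf L hL).2

lemma not_dvd_forms (hf : ∀ L ∈ A, frm L ≠ 0 ∧ LinearMap.ker (frm L) = L) (hH : H ∈ A)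
    {L : Submodule K (Fin ℓ → K)} (hL : L ∈ A.erase H) :
    ¬ linPoly (frm L) ∣ linPoly (frm H) := by
  intro h
  have hLA := Finset.mem_of_mem_erase hL
  have := linPoly_dvd_ker (hf L hLA).1 (hf H hH).1 h
  rw [(hf L hLA).2, (hf H hH).2] at this
  exact Finset.ne_of_mem_erase hL this

lemma spog (hf : ∀ L ∈ A, frm L ≠ 0 ∧ LinearMap.ker (frm L) = L) (hH : H ∈ A)
    {θ : Fin ℓ → Deriv K ℓ} (hg : GeneratesD A θ) (hi : IndepD θ) {e : Fin ℓ → ℕ}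
    (he : ∀ i, HomogDeriv (θ i) (e i)) {d : ℕ} (hd1 : 1 ≤ d)
    (hd : d + (restrict A H).card = A.card) :
    ∃ (f : Fin ℓ → MvPolynomial (Fin ℓ) K) (η : Deriv K ℓ),
      linPoly (frm H) • η = ∑ i, f i • θ i ∧
      (∀ i, d < e i → f i = 0) ∧ (∀ i, d ≠ e i → constantCoeff (f i) = 0) ∧
      InD (A.erase H) η ∧
      (∀ ξ, InD (A.erase H) ξ → ∃ s : MvPolynomial (Fin ℓ) K, InD A (ξ - s • η)) ∧
      ∃ i, ¬ linPoly (frm H) ∣ f i := by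
  obtain ⟨j, hj⟩ := exists_coord (hf H hH).1
  have hsum := sum_exp ⟨H, hH⟩ frm hf hg hi he
  have hle : ∀ i, e i ≤ A.card := fun i => by
    rw [← hsum]; exact Finset.single_le_sum (fun _ _ => Nat.zero_le _) (Finset.mem_univ i)
  have hrep : ∀ X, ∃ L, X ∈ restrict A H → L ∈ A.erase H ∧ L ⊓ H = X := by
    intro X
    by_cases hX : X ∈ restrict A H
    · obtain ⟨L, hL, hLX⟩ := Finset.mem_image.1 hX
      exact ⟨L, fun _ => ⟨hL, hLX⟩⟩
    · exact ⟨⊥, fun h => absurd h hX⟩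
  choose rep hrep using hrep
  set β : Submodule K (Fin ℓ → K) → MvPolynomial (Fin ℓ) K :=
    fun X => linPoly (tau (frm H) j (frm (rep X))) with hβ
  set k : Submodule K (Fin ℓ → K) → ℕ :=
    fun X => ((A.erase H).filter (fun L' => L' ⊓ H = X)).card - 1 with hk
  have hβp : ∀ X ∈ restrict A H, Prime (β X) := fun X hX =>
    linPoly_prime (tau_ne_zero hf hH (hrep X hX).1)
  have hβne : ∀ X ∈ restrict A H, ∀ Y ∈ restrict A H, β X ∣ β Y → X = Y := by
    intro X hX Y hY h
    rw [← (hrep X hX).2, ← (hrep Y hY).2]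
    exact trace_of_tau_dvd hf hH (hrep X hX).1 (hrep Y hY).1 h
  have hβs : ∀ X, sig (frm H) j (β X) = β X := fun X => by
    simp only [hβ]; rw [← sig_lin, sig_idem hj]
  have hksum : ∑ X ∈ restrict A H, k X = d - 1 := by
    have h1 : (A.erase H).card = ∑ X ∈ restrict A H,
        ((A.erase H).filter (fun L' => L' ⊓ H = X)).card :=
      Finset.card_eq_sum_card_image (fun L => L ⊓ H) (A.erase H)
    have h2 : ∀ X ∈ restrict A H, ((A.erase H).filter (fun L' => L' ⊓ H = X)).card = k X + 1 := by
      intro X hX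
      have : 0 < ((A.erase H).filter (fun L' => L' ⊓ H = X)).card :=
        Finset.card_pos.2 ⟨rep X, Finset.mem_filter.2 (hrep X hX)⟩
      simp only [hk]; omega
    rw [Finset.sum_congr rfl h2, Finset.sum_add_distrib, Finset.card_erase_of_mem hH] at h1
    simp at h1
    omega
  -- the two products
  set B := ∏ X ∈ restrict A H, β X with hB
  set b := ∏ X ∈ restrict A H, β X ^ k X with hb
  have hB0 : B ≠ 0 := Finset.prod_ne_zero_iff.2 fun X hX => (hβp X hX).ne_zero
  have hb0 : b ≠ 0 := Finset.prod_ne_zero_iff.2 fun X hX => pow_ne_zero _ (hβp X hX).ne_zero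
  have hBs : sig (frm H) j B = B := by
    rw [hB, map_prod]; exact Finset.prod_congr rfl fun X _ => hβs X
  have hbs : sig (frm H) j b = b := by
    rw [hb, map_prod]; exact Finset.prod_congr rfl fun X _ => by rw [map_pow, hβs X]
  have hBh : B.IsHomogeneous (restrict A H).card := by
    have := IsHomogeneous.prod (restrict A H) β (fun _ => 1) fun L _ => linPoly_homog _
    simpa using this
  have hbh : b.IsHomogeneous (d - 1) := by
    rw [← hksum]
    exact IsHomogeneous.prod (restrict A H) (fun X => β X ^ k X) k fun X _ => by
      have := (linPoly_homog (tau (frm H) j (frm (rep X)))).pow (k X)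
      rwa [one_mul] at this
  have hBadj : ∀ i, B ∣ sig (frm H) j ((Matrix.of θ).adjugate j i) := by
    intro i
    have := prod_pow_dvd (restrict A H) β (fun _ => 1) hβp hβne
      (sig (frm H) j ((Matrix.of θ).adjugate j i)) (fun X hX => by
        rw [pow_one]; exact adj_one hf hH hj hg.1 (hrep X hX).1 i)
    simpa using this
  have hbter : ∀ ξ, InD (A.erase H) ξ → b ∣ sig (frm H) j (applyLin ξ (frm H)) := by
    intro ξ hξ
    refine prod_pow_dvd (restrict A H) β k hβp hβne _ fun X hX => ?_
    have := terao_one hf hH hj hξ (hrep X hX).1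
    rwa [(hrep X hX).2] at this
  choose f0 hf0 using hBadj
  set f : Fin ℓ → MvPolynomial (Fin ℓ) K := fun i => sig (frm H) j (f0 i) with hfdef
  have hfs : ∀ i, sig (frm H) j (f i) = f i := fun i => sig_idem hj _
  have hfB : ∀ i, sig (frm H) j ((Matrix.of θ).adjugate j i) = B * f i := by
    intro i
    rw [← sig_idem hj, hf0, map_mul, hBs]
  have hadjh : ∀ i, (B * f i).IsHomogeneous (A.card - e i) := by
    intro i
    rw [← hfB, ← hsum]
    exact sig_homog _ _ (adj_homog _ _ (fun i k => he i k) j i)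
  have hfz : ∀ i, d < e i → f i = 0 := fun i hlt =>
    zero_of_mul_homog hBh hB0 (hadjh i) (by have := hle i; omega)
  have hfc : ∀ i, d ≠ e i → constantCoeff (f i) = 0 := fun i hne =>
    cc_of_mul_homog hBh hB0 (hadjh i) (by have := hle i; omega)
  have hfh : ∀ i k, (f i * θ i k).IsHomogeneous d := by
    intro i k
    by_cases hlt : d < e i
    · rw [hfz i hlt, zero_mul]; exact isHomogeneous_zero _ _ _
    · have h1 : (f i).IsHomogeneous (d - e i) := by
        refine homog_of_mul_homog hBh hB0 ?_
        have h2 : (restrict A H).card + (d - e i) = A.card - e i := by have := hle i; omega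
        rw [h2]; exact hadjh i
      have := h1.mul (he i k)
      rwa [Nat.sub_add_cancel (not_lt.1 hlt)] at this
  have hdvd : ∀ k, linPoly (frm H) ∣ ∑ i, f i * θ i k := by
    intro k
    rw [← sig_eq_zero_iff hj]
    apply mul_left_cancel₀ hB0
    have h1 := congrFun (congrFun (Matrix.adjugate_mul (Matrix.of θ)) j) k
    have h2 := congrArg (sig (frm H) j) h1
    rw [Matrix.smul_apply, smul_eq_mul, map_mul,
      (sig_eq_zero_iff hj _).2 (form_dvd_det frm hf hg hH), zero_mul, Matrix.mul_apply,
      map_sum] at h2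
    rw [mul_zero, ← h2, map_sum, Finset.mul_sum]
    refine Finset.sum_congr rfl fun i _ => ?_
    rw [map_mul, map_mul, hfB, hfs, mul_assoc]; rfl
  choose η hη using hdvd
  have hα0 := (linPoly_prime (hf H hH).1).ne_zero
  have hrel : linPoly (frm H) • η = ∑ i, f i • θ i := by
    funext k
    simp [← hη k]
  have hηh : ∀ k, (η k).IsHomogeneous (d - 1) := by
    intro k
    refine homog_of_mul_homog (linPoly_homog (frm H)) hα0 ?_
    rw [← hη k, Nat.add_sub_cancel' hd1]
    exact IsHomogeneous.sum _ _ _ fun i _ => hfh i k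
  have h5 : ∃ i, ¬ linPoly (frm H) ∣ f i := by
    by_contra hc
    push Not at hc
    apply sq_not_dvd_det frm hf hg hH
    rw [← (C_isUnit hj).dvd_mul_right, det_mul_coord]
    refine Finset.dvd_sum fun i _ => mul_dvd_mul ?_ (hg.1 i H hH _ (hf H hH).2)
    rw [← sig_eq_zero_iff hj, hfB]
    have := (sig_eq_zero_iff hj _).2 (hc i)
    rw [hfs] at this
    rw [this, mul_zero]
  have h3 : InD (A.erase H) η := by
    refine inD_of (A.erase H) frm (fun L hL => hf L (Finset.mem_of_mem_erase hL)) η fun L hL => ?_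
    have hLA := Finset.mem_of_mem_erase hL
    have h1 : linPoly (frm L) ∣ linPoly (frm H) * applyLin η (frm L) := by
      rw [← applyLin_smul_left, hrel, applyLin_sum_left]
      refine Finset.dvd_sum fun i _ => ?_
      rw [applyLin_smul_left]
      exact (hg.1 i L hLA _ (hf L hLA).2).mul_left _
    exact ((linPoly_prime (hf L hLA).1).dvd_or_dvd h1).resolve_left (not_dvd_forms hf hH hL)
  refine ⟨f, η, hrel, hfz, hfc, h3, ?_, h5⟩
  have hp0 : sig (frm H) j (applyLin η (frm H)) ≠ 0 := by
    intro h0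
    obtain ⟨c, hc⟩ := hg.2 η (inD_of_erase hf h3 ((sig_eq_zero_iff hj _).1 h0))
    obtain ⟨i, hi'⟩ := h5
    apply hi'
    have h6 : ∑ i, (f i - linPoly (frm H) * c i) • θ i = 0 := by
      simp only [sub_smul, Finset.sum_sub_distrib, mul_smul]
      rw [← hrel, ← Finset.smul_sum, ← hc, sub_self]
    exact ⟨c i, sub_eq_zero.1 (hi _ h6 i)⟩
  obtain ⟨u, hu⟩ := hbter η h3
  have hph : (sig (frm H) j (applyLin η (frm H))).IsHomogeneous (d - 1) :=
    sig_homog _ _ (IsHomogeneous.sum _ _ _ fun i _ => (hηh i).C_mul _)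
  have hu0 : u.IsHomogeneous 0 := homog_of_mul_homog hbh hb0 (by rw [← hu]; exact hph)
  have huC : u = C (coeff 0 u) :=
    totalDegree_eq_zero_iff_eq_C.1 ((totalDegree_zero_iff_isHomogeneous _).2 hu0)
  set c := coeff 0 u with hc
  have hc0 : c ≠ 0 := by
    intro h
    rw [h, C_0] at huC
    rw [huC, mul_zero] at hu
    exact hp0 hu
  intro ξ hξ
  obtain ⟨t, ht⟩ := hbter ξ hξ
  have htt : b * sig (frm H) j t = b * t := by
    have h := sig_idem hj (applyLin ξ (frm H))
    rw [ht, map_mul, hbs] at h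
    exact h
  refine ⟨C c⁻¹ * t, inD_of_erase (H := H) hf ?_ ?_⟩
  · intro L hL ψ hψ
    rw [applyLin_sub_left, applyLin_smul_left]
    exact dvd_sub (hξ L hL ψ hψ) ((h3 L hL ψ hψ).mul_left _)
  · have h1 : (C c⁻¹ * C c : MvPolynomial (Fin ℓ) K) = 1 := by
      rw [← C_mul, inv_mul_cancel₀ hc0, C_1]
    rw [← sig_eq_zero_iff hj, applyLin_sub_left, applyLin_smul_left, map_sub, map_mul, map_mul,
      algHom_C, ht, hu, huC]
    change b * t - C c⁻¹ * sig (frm H) j t * (b * C c) = 0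
    linear_combination (- sig (frm H) j t * b) * h1 - htt

lemma linPoly_mem_of_inf (P : Ideal (MvPolynomial (Fin ℓ) K))
    (B : Finset (Submodule K (Fin ℓ → K)))
    (hf : ∀ L ∈ B, LinearMap.ker (frm L) = L) (hB : ∀ L ∈ B, linPoly (frm L) ∈ P)
    (ψ : Module.Dual K (Fin ℓ → K)) (h : B.inf id ≤ LinearMap.ker ψ) : linPoly ψ ∈ P := by
  have := mem_span_of_iInf_ker_le_ker (ι := B) (L := fun L => frm L.1) (K := ψ) (by
    refine le_trans ?_ h
    refine Finset.le_inf fun L hL => ?_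
    refine (iInf_le _ (⟨L, hL⟩ : B)).trans ?_
    simp [hf L hL])
  refine Submodule.span_induction (p := fun ψ _ => linPoly ψ ∈ P) ?_ ?_ ?_ ?_ this
  · rintro _ ⟨L, rfl⟩; exact hB _ L.2
  · rw [linPoly_zero]; exact P.zero_mem
  · intro x y _ _ hx hy; rw [linPoly_add]; exact P.add_mem hx hy
  · intro a x _ hx; rw [linPoly_smul]; exact P.mul_mem_left _ hx

lemma linPoly_proj (i : Fin ℓ) : linPoly (LinearMap.proj i : Module.Dual K (Fin ℓ → K)) = X i := by
  rw [linPoly, Finset.sum_eq_single_of_mem i (Finset.mem_univ i)]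
  · simp
  · intro b _ hb
    simp [Pi.single_apply, hb.symm]

end Part5

section Part6

variable {A : Finset (Submodule K (Fin ℓ → K))}
    {frm : Submodule K (Fin ℓ → K) → Module.Dual K (Fin ℓ → K)}
    {H : Submodule K (Fin ℓ → K)}

lemma card_restrict_of_inf (hf : ∀ L ∈ A, frm L ≠ 0 ∧ LinearMap.ker (frm L) = L) (hH : H ∈ A)
    (hEss : Essential A) (hne : (A.erase H).inf id ≠ ⊥) :
    (restrict A H).card + 1 = A.card := by
  obtain ⟨v, hv, hv0⟩ := (Submodule.ne_bot_iff _).1 hne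
  have hvL : ∀ L ∈ A.erase H, v ∈ L := fun L hL => (Finset.inf_le hL : _ ≤ id L) hv
  have hvH : v ∉ H := by
    intro h
    apply hv0
    have h1 : A.inf id = H ⊓ (A.erase H).inf id := by
      conv_lhs => rw [← Finset.insert_erase hH]
      rw [Finset.inf_insert]; rfl
    have h2 : v ∈ A.inf id := by rw [h1]; exact ⟨h, hv⟩
    rw [hEss] at h2
    simpa using h2
  have hφ : frm H v ≠ 0 := by
    intro h
    apply hvH
    rw [← (hf H hH).2]
    exact h
  have key : ∀ L ∈ A.erase H, ∀ L' ∈ A.erase H, L ⊓ H = L' ⊓ H → L ≤ L' := by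
    intro L hL L' hL' h w hw
    have h1 : w - (frm H w / frm H v) • v ∈ L ⊓ H := by
      refine ⟨L.sub_mem hw (L.smul_mem _ (hvL L hL)), ?_⟩
      have : w - (frm H w / frm H v) • v ∈ LinearMap.ker (frm H) := by
        rw [LinearMap.mem_ker, map_sub, map_smul, smul_eq_mul, div_mul_cancel₀ _ hφ, sub_self]
      rwa [(hf H hH).2] at this
    rw [h] at h1
    have := L'.add_mem h1.1 (L'.smul_mem (frm H w / frm H v) (hvL L' hL'))
    simpa using this
  have : (restrict A H).card = (A.erase H).card := by
    apply Finset.card_image_of_injOn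
    intro L hL L' hL' h
    exact le_antisymm (key L hL L' hL' h) (key L' hL' L hL h.symm)
  rw [this, Finset.card_erase_add_one hH]

lemma InD.mono {B : Finset (Submodule K (Fin ℓ → K))} (h : B ⊆ A) {η : Deriv K ℓ}
    (hη : InD A η) : InD B η := fun L hL => hη L (h hL)

lemma InD_euler : InD A (eulerD : Deriv K ℓ) := fun L _ φ _ => by rw [applyLin_euler]

/-- The local step. -/
lemma local_step (hf : ∀ L ∈ A, frm L ≠ 0 ∧ LinearMap.ker (frm L) = L) (hH : H ∈ A)
    {θ : Fin ℓ → Deriv K ℓ} (hg : GeneratesD A θ) (hi : IndepD θ)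
    (hlf : LocallyFree (A.erase H)) (hinf : (A.erase H).inf id = ⊥)
    {f : Fin ℓ → MvPolynomial (Fin ℓ) K} {η : Deriv K ℓ}
    (hrel : linPoly (frm H) • η = ∑ i, f i • θ i)
    (hη : InD (A.erase H) η)
    (hgen : ∀ ξ, InD (A.erase H) ξ → ∃ s : MvPolynomial (Fin ℓ) K, InD A (ξ - s • η))
    (hnd : ∃ i, ¬ linPoly (frm H) ∣ f i)
    (P : Ideal (MvPolynomial (Fin ℓ) K)) (hP : P.IsPrime) (hα : linPoly (frm H) ∈ P)
    (hfP : ∀ i, f i ∈ P) (hX : ∃ i, (X i : MvPolynomial (Fin ℓ) K) ∉ P) : False := by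
  set B := (A.erase H).filter (fun L => linPoly (frm L) ∈ P) with hB
  have hBA : B ⊆ A.erase H := Finset.filter_subset _ _
  have hf' : ∀ L ∈ A.erase H, frm L ≠ 0 ∧ LinearMap.ker (frm L) = L :=
    fun L hL => hf L (Finset.mem_of_mem_erase hL)
  have hmem := linPoly_mem_of_inf (frm := frm) P B (fun L hL => (hf' L (hBA hL)).2)
    (fun L hL => (Finset.mem_filter.1 hL).2)
  have hlat : B.inf id ∈ latticeOf ⊤ (A.erase H) := by
    refine Finset.mem_image.2 ⟨B, Finset.mem_powerset.2 hBA, ?_⟩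
    rw [top_inf_eq]
  have hne : B.inf id ≠ (A.erase H).inf id := by
    rw [hinf]
    intro h
    obtain ⟨i, hXi⟩ := hX
    apply hXi
    rw [← linPoly_proj]
    apply hmem
    rw [h]; exact bot_le
  have hloc : localize (A.erase H) (B.inf id) = B := by
    ext L
    simp only [localize, Finset.mem_filter, hB]
    refine and_congr_right fun hL => ⟨fun h => ?_, fun h => ?_⟩
    · apply hmem
      rw [(hf' L hL).2]; exact h
    · have hLB : L ∈ B := Finset.mem_filter.2 ⟨hL, h⟩
      exact (Finset.inf_le hLB : _ ≤ id L)
  obtain ⟨e', ψ, -, hψg, hψi⟩ := hlf _ hlat hne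
  rw [hloc] at hψg
  set q := ∏ L ∈ (A.erase H).filter (fun L => linPoly (frm L) ∉ P), linPoly (frm L) with hq
  have hqP : q ∉ P := by
    rw [hq, hP.prod_mem_iff]
    rintro ⟨L, hL, h⟩
    exact (Finset.mem_filter.1 hL).2 h
  let w : Option (Fin ℓ) → Deriv K ℓ := fun o => o.elim η θ
  refine local_contra w ψ P hP q hqP ?_ ?_ ?_
  · intro g hgw
    rw [Fintype.sum_option] at hgw
    change g none • η + ∑ i, g (some i) • θ i = 0 at hgw
    have h1 : ∑ i, (g none * f i + linPoly (frm H) * g (some i)) • θ i = 0 := by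
      have := congrArg (fun z => linPoly (frm H) • z) hgw
      simp only [smul_add, smul_zero] at this
      rw [smul_comm, hrel] at this
      simp only [add_smul, Finset.sum_add_distrib, mul_smul]
      rw [← Finset.smul_sum, ← Finset.smul_sum]
      exact this
    have h2 := hi _ h1
    obtain ⟨i0, hi0⟩ := hnd
    have hpr := linPoly_prime (hf H hH).1
    have h3 : linPoly (frm H) ∣ g none := by
      refine (hpr.dvd_or_dvd (b := f i0) ⟨- g (some i0), ?_⟩).resolve_right hi0
      linear_combination h2 i0
    obtain ⟨t, ht⟩ := h3
    intro o
    cases o with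
    | none => rw [ht]; exact P.mul_mem_right _ hα
    | some i =>
      have h4 : g (some i) = -t * f i := by
        apply mul_left_cancel₀ hpr.ne_zero
        have := h2 i
        rw [ht] at this
        linear_combination this
      rw [h4]; exact P.mul_mem_left _ (hfP i)
  · intro o
    cases o with
    | none => exact hψg.2 η (hη.mono hBA)
    | some i => exact hψg.2 (θ i) ((hg.1 i).mono (hBA.trans (Finset.erase_subset _ _)))
  · intro k
    have h1 : InD (A.erase H) (q • ψ k) := by
      refine inD_of _ frm hf' _ fun L hL => ?_
      rw [applyLin_smul_left]
      by_cases hLP : linPoly (frm L) ∈ P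
      · exact (hψg.1 k L (Finset.mem_filter.2 ⟨hL, hLP⟩) _ (hf' L hL).2).mul_left _
      · exact (Finset.dvd_prod_of_mem (fun L => linPoly (frm L))
          (Finset.mem_filter.2 ⟨hL, hLP⟩)).mul_right _
    obtain ⟨s, hs⟩ := hgen _ h1
    obtain ⟨c, hc⟩ := hg.2 _ hs
    refine ⟨fun o => o.elim s c, ?_⟩
    rw [Fintype.sum_option]
    change _ = s • η + ∑ i, c i • θ i
    rw [← hc, add_sub_cancel]

lemma main_lemma (hf : ∀ L ∈ A, frm L ≠ 0 ∧ LinearMap.ker (frm L) = L) (hH : H ∈ A)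
    (hl : 1 ≤ ℓ)
    {θ : Fin ℓ → Deriv K ℓ} (hg : GeneratesD A θ) (hi : IndepD θ) {e : Fin ℓ → ℕ}
    (he : ∀ i, HomogDeriv (θ i) (e i)) {d : ℕ} (hd1 : 1 ≤ d)
    (hd : d + (restrict A H).card = A.card)
    (hlf : LocallyFree (A.erase H)) (hinf : (A.erase H).inf id = ⊥)
    (hde : ∀ i, d ≠ e i) (la : Fin ℓ) (hla : d < e la) : False := by
  obtain ⟨f, η, hrel, hfz, hfc, hη, hgen, hnd⟩ := spog hf hH hg hi he hd1 hd
  have hne : (A.erase H).Nonempty := by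
    rw [Finset.nonempty_iff_ne_empty]
    intro h
    rw [h, Finset.inf_empty] at hinf
    have h1 : (Pi.single ⟨0, hl⟩ 1 : Fin ℓ → K) ∈ (⊤ : Submodule K (Fin ℓ → K)) :=
      Submodule.mem_top
    rw [hinf, Submodule.mem_bot] at h1
    have := congrFun h1 ⟨0, hl⟩
    simp at this
  obtain ⟨L0, hL0⟩ := hne
  have hL0A := Finset.mem_of_mem_erase hL0
  have hp0 := (linPoly_prime (hf L0 hL0A).1).ne_zero
  have hker := (hf L0 hL0A).2
  have hh : ∀ i, ∃ h, applyLin (θ i) (frm L0) = linPoly (frm L0) * h :=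
    fun i => hg.1 i L0 hL0A _ hker
  choose h hh using hh
  obtain ⟨kk, hkk⟩ := hη L0 hL0 _ hker
  have hsum : ∑ i, f i * h i = linPoly (frm H) * kk := by
    apply mul_left_cancel₀ hp0
    have h1 := congrArg (fun z => applyLin z (frm L0)) hrel
    simp only [applyLin_smul_left, applyLin_sum_left, hh, hkk] at h1
    rw [Finset.mul_sum, mul_left_comm, h1]
    exact Finset.sum_congr rfl fun i _ => by ring
  obtain ⟨c, hc⟩ := hg.2 _ (InD_euler (A := A))
  have hch : ∑ i, c i * h i = 1 := by
    apply mul_left_cancel₀ hp0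
    have h1 := congrArg (fun z => applyLin z (frm L0)) hc
    simp only [applyLin_smul_left, applyLin_sum_left, hh, applyLin_euler] at h1
    rw [Finset.mul_sum, mul_one]
    conv_rhs => rw [h1]
    exact Finset.sum_congr rfl fun i _ => by ring
  have hex : ∃ i0, constantCoeff (h i0) ≠ 0 := by
    by_contra hcon
    push Not at hcon
    have := congrArg constantCoeff hch
    simp [hcon] at this
  obtain ⟨i0, hi0⟩ := hex
  have hlast : constantCoeff (h la) = 0 := by
    refine cc_of_mul_homog (n := e la) (linPoly_homog (frm L0)) hp0 ?_ (by omega)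
    rw [← hh]
    exact IsHomogeneous.sum _ _ _ fun i _ => (he la i).C_mul _
  have hi0l : i0 ≠ la := by rintro rfl; exact hi0 hlast
  have hccα : constantCoeff (linPoly (frm H)) = 0 := by
    simp [linPoly]
  set s : Finset (MvPolynomial (Fin ℓ) K) :=
    insert (linPoly (frm H)) ((Finset.univ \ {i0, la}).image f) with hs
  have hcard : s.card < ℓ := by
    have h1 := Finset.card_insert_le (linPoly (frm H)) ((Finset.univ \ {i0, la}).image f)
    have h2 := Finset.card_image_le (s := Finset.univ \ {i0, la}) (f := f)
    have h3 := Finset.card_sdiff_add_card_eq_card (Finset.subset_univ ({i0, la} : Finset (Fin ℓ)))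
    rw [Finset.card_pair hi0l, Finset.card_univ, Fintype.card_fin] at h3
    rw [hs]
    omega
  obtain ⟨P, hP, hsP, hPc, hX⟩ := exists_prime s hcard (by
    intro p hp
    rcases Finset.mem_insert.1 hp with rfl | hp
    · exact hccα
    · obtain ⟨i, -, rfl⟩ := Finset.mem_image.1 hp
      exact hfc i (hde i))
  have hα : linPoly (frm H) ∈ P := hsP _ (Finset.mem_insert_self _ _)
  have hfP1 : ∀ i, i ≠ i0 → f i ∈ P := by
    intro i hii
    by_cases hil : i = la
    · rw [hil, hfz la hla]; exact P.zero_mem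
    · exact hsP _ (Finset.mem_insert_of_mem (Finset.mem_image_of_mem _ (by simp [hii, hil])))
  have hfP : ∀ i, f i ∈ P := by
    intro i
    by_cases hii : i = i0
    · subst hii
      have h1 : f i * h i ∈ P := by
        rw [← Finset.add_sum_erase _ _ (Finset.mem_univ i)] at hsum
        rw [eq_sub_of_add_eq hsum]
        refine P.sub_mem (P.mul_mem_right _ hα) (P.sum_mem fun k hk => ?_)
        exact P.mul_mem_right _ (hfP1 k (Finset.ne_of_mem_erase hk))
      exact (hP.mem_or_mem h1).resolve_right fun h2 => hi0 (hPc _ h2)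
    · exact hfP1 i hii
  exact local_step hf hH hg hi hlf hinf hrel hη hgen hnd P hP hα hfP hX

end Part6

/-- Corollary `roots`: if `A` is free with
`exp(A) = (1, d₂, …, d_ℓ)` increasing and `A' = A \ {H}` is locally free, then
`d := |A| - |A^H|` equals some `dᵢ`, or `d > d_ℓ`. -/
theorem deletion_degree_root_or_large {K : Type} [Field K] {ℓ : ℕ} (hl : 1 ≤ ℓ)
    (A : Finset (Submodule K (Fin ℓ → K)))
    (hA : IsArrangement A) (hEss : Essential A)
    (e : Fin ℓ → ℕ) (he0 : e ⟨0, by omega⟩ = 1) (hmono : Monotone e)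
    (hfree : IsFreeExp A e)
    (H : Submodule K (Fin ℓ → K)) (hH : H ∈ A)
    (hlf : LocallyFree (A.erase H))
    (d : ℕ) (hd : (d : ℤ) = (A.card : ℤ) - ((restrict A H).card : ℤ)) :
    (∃ i, d = e i) ∨ e ⟨ℓ - 1, by omega⟩ < d := by
  by_contra hcon
  push Not at hcon
  obtain ⟨hde, hle⟩ := hcon
  have hfr : ∀ L, ∃ φ : Module.Dual K (Fin ℓ → K), L ∈ A → φ ≠ 0 ∧ LinearMap.ker φ = L := by
    intro L
    by_cases hL : L ∈ A
    · obtain ⟨φ, hφ⟩ := hA L hL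
      exact ⟨φ, fun _ => hφ⟩
    · exact ⟨0, fun h => absurd h hL⟩
  choose frm hf using hfr
  have hle1 : (restrict A H).card ≤ (A.erase H).card := Finset.card_image_le
  have hce := Finset.card_erase_add_one hH
  by_cases hinf : (A.erase H).inf id = ⊥
  · obtain ⟨θ, he, hg, hi⟩ := hfree
    exact main_lemma hf hH hl hg hi he (by omega) (by omega) hlf hinf hde _
      (lt_of_le_of_ne hle (hde _))
  · have := card_restrict_of_inf hf hH hEss hinf
    apply hde ⟨0, by omega⟩
    rw [he0]
    omega

end ArrPOG
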